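/- Let U ⊆ ℝ³ be open with coordinates q = (q₁,q₂,q₃), let Φ : U → ℝ³ be a C² orthogonal curvilinear coordinate map (pairwise orthogonal nonvanishing partials, metric coefficients hᵢ, right-handed frame uᵢ), and let f ∈ C¹(Ω; ℍ(ℂ)) where Ω is open and Φ(U) ⊆ Ω, with component functions F₀,F₁,F₂,F₃ : U → ℂ defined by (f∘Φ)(q) = F₀(q) + F₁(q)u₁(q) + F₂(q)u₂(q) + F₃(q)u₃(q). Then for every q ∈ U: D_MT[f](Φ(q)) = −(1/(h₁h₂h₃))[∂(h₂h₃F₁)/∂q₁ + ∂(h₁h₃F₂)/∂q₂ + ∂(h₁h₂F₃)/∂q₃] + {(1/h₁)∂F₀/∂q₁ + (1/(h₂h₃))[∂(h₃F₃)/∂q₂ − ∂(h₂F₂)/∂q₃]}u₁ + {(1/h₂)∂F₀/∂q₂ + (1/(h₁h₃))[∂(h₁F₁)/∂q₃ − ∂(h₃F₃)/∂q₁]}u₂ + {(1/h₃)∂F₀/∂q₃ + (1/(h₁h₂))[∂(h₂F₂)/∂q₁ − ∂(h₁F₁)/∂q₂]}u₃, all metric coefficients, frame vectors and partial derivatives being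 evaluated at q. -/

import Mathlib

open Quaternion

noncomputable section

/-- Points of `ℝ³`. -/
abbrev P3 := Fin 3 → ℝ
/-- Vectors of `ℂ³`. -/
abbrev V3 := Fin 3 → ℂ

/-- Partial derivative `∂g/∂qᵢ` of a complex-valued function on `ℝ³`. -/
def pd (i : Fin 3) (g : P3 → ℂ) : P3 → ℂ := fun p => fderiv ℝ g p (Pi.single i 1)

/-- Gradient of a scalar field, extended ℂ-linearly. -/
def grad (g : P3 → ℂ) : P3 → V3 := fun p => ![pd 0 g p, pd 1 g p, pd 2 g p]

/-- Divergence of a `ℂ³`-valued vector field. -/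
def div3 (F : P3 → V3) : P3 → ℂ := fun p =>
  pd 0 (fun q => F q 0) p + pd 1 (fun q => F q 1) p + pd 2 (fun q => F q 2) p

/-- Curl of a `ℂ³`-valued vector field. -/
def curl (F : P3 → V3) : P3 → V3 := fun p =>
  ![pd 1 (fun q => F q 2) p - pd 2 (fun q => F q 1) p,
    pd 2 (fun q => F q 0) p - pd 0 (fun q => F q 2) p,
    pd 0 (fun q => F q 1) p - pd 1 (fun q => F q 0) p]

/-- Scalar Laplacian `∂²/∂x² + ∂²/∂y² + ∂²/∂z²` of a complex-valued function. -/
def lap (g : P3 → ℂ) : P3 → ℂ := fun p =>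
  pd 0 (pd 0 g) p + pd 1 (pd 1 g) p + pd 2 (pd 2 g) p

/-- A `ℂ³`-valued field is `Cⁿ` on a set iff each component is. -/
def VContDiffOn (n : ℕ) (F : P3 → V3) (Ω : Set P3) : Prop :=
  ∀ i : Fin 3, ContDiffOn ℝ n (fun q => F q i) Ω

/-- The quaternionic imaginary unit `i₁`. -/
def qi : ℍ[ℂ] := ⟨0, 1, 0, 0⟩
/-- The quaternionic imaginary unit `i₂`. -/
def qj : ℍ[ℂ] := ⟨0, 0, 1, 0⟩
/-- The quaternionic imaginary unit `i₃`. -/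
def qk : ℍ[ℂ] := ⟨0, 0, 0, 1⟩

/-- The complex quaternion with scalar part `s` and vector part `v ∈ ℂ³`. -/
def mkQ (s : ℂ) (v : V3) : ℍ[ℂ] := ⟨s, v 0, v 1, v 2⟩

/-- Scalar part of a complex quaternion. -/
def scQ (a : ℍ[ℂ]) : ℂ := a.re
/-- Vector part of a complex quaternion, identified with a vector in `ℂ³`. -/
def vecQ (a : ℍ[ℂ]) : V3 := ![a.imI, a.imJ, a.imK]

/-- Partial derivative `∂f/∂qᵢ` of an `ℍ(ℂ)`-valued function on `ℝ³`
(computed, as usual for vector-valued functions, componentwise). -/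
def qpd (i : Fin 3) (f : P3 → ℍ[ℂ]) : P3 → ℍ[ℂ] := fun p =>
  ⟨pd i (fun q => (f q).re) p, pd i (fun q => (f q).imI) p,
   pd i (fun q => (f q).imJ) p, pd i (fun q => (f q).imK) p⟩

/-- The Moisil–Theodoresco operator `D_MT[f] = i₁ ∂f/∂x + i₂ ∂f/∂y + i₃ ∂f/∂z`
(quaternionic multiplication on the left). -/
def DMT (f : P3 → ℍ[ℂ]) : P3 → ℍ[ℂ] := fun p =>
  qi * qpd 0 f p + qj * qpd 1 f p + qk * qpd 2 f p

/-- The right Moisil–Theodoresco operator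
`D^r_MT[f] = (∂f/∂x) i₁ + (∂f/∂y) i₂ + (∂f/∂z) i₃`. -/
def DMTr (f : P3 → ℍ[ℂ]) : P3 → ℍ[ℂ] := fun p =>
  qpd 0 f p * qi + qpd 1 f p * qj + qpd 2 f p * qk

/-- An `ℍ(ℂ)`-valued function is `Cⁿ` on a set iff each of its four
complex component functions is. -/
def QContDiffOn (n : ℕ) (f : P3 → ℍ[ℂ]) (Ω : Set P3) : Prop :=
  ContDiffOn ℝ n (fun q => (f q).re) Ω ∧ ContDiffOn ℝ n (fun q => (f q).imI) Ω ∧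
    ContDiffOn ℝ n (fun q => (f q).imJ) Ω ∧ ContDiffOn ℝ n (fun q => (f q).imK) Ω

/-- The scalar part `f₀` of an `ℍ(ℂ)`-valued function. -/
def sc (f : P3 → ℍ[ℂ]) : P3 → ℂ := fun q => (f q).re
/-- The vector part `f⃗` of an `ℍ(ℂ)`-valued function, as a `ℂ³`-valued field. -/
def vf (f : P3 → ℍ[ℂ]) : P3 → V3 := fun q => vecQ (f q)

/-- Real (bilinear) dot product on `ℝ³`. -/
def dotR (v w : P3) : ℝ := v 0 * w 0 + v 1 * w 1 + v 2 * w 2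

/-- Complex bilinear "inner product" on `ℂ³` (no conjugation). -/
def dotC (v w : V3) : ℂ := v 0 * w 0 + v 1 * w 1 + v 2 * w 2

/-- Cross product on `ℝ³`. -/
def crossR (v w : P3) : P3 :=
  ![v 1 * w 2 - v 2 * w 1, v 2 * w 0 - v 0 * w 2, v 0 * w 1 - v 1 * w 0]

/-- A real vector of `ℝ³` viewed inside `ℂ³`. -/
def c3 (v : P3) : V3 := fun i => (v i : ℂ)

/-- Partial derivative `∂Φ/∂qᵢ` of a map `Φ : ℝ³ → ℝ³`. -/
def pdv (i : Fin 3) (Φ : P3 → P3) (q : P3) : P3 := fderiv ℝ Φ q (Pi.single i 1)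

/-- `Φ` is an orthogonal curvilinear coordinate map on `U`: its partial derivatives
are pairwise orthogonal and nonvanishing at each point of `U`. -/
def IsOrthogonalCurvilinear (Φ : P3 → P3) (U : Set P3) : Prop :=
  ∀ q ∈ U, (∀ i j : Fin 3, i ≠ j → dotR (pdv i Φ q) (pdv j Φ q) = 0) ∧
    ∀ i : Fin 3, pdv i Φ q ≠ 0

/-- Metric (Lamé) coefficient `hᵢ(q) = ‖∂Φ/∂qᵢ(q)‖` (Euclidean norm). -/
def mcoef (Φ : P3 → P3) (i : Fin 3) (q : P3) : ℝ :=
  Real.sqrt (dotR (pdv i Φ q) (pdv i Φ q))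

/-- Orthonormal frame `uᵢ(q) = hᵢ(q)⁻¹ ∂Φ/∂qᵢ(q)`. -/
def frame (Φ : P3 → P3) (i : Fin 3) (q : P3) : P3 := (mcoef Φ i q)⁻¹ • pdv i Φ q

/-- The frame is right-handed: `u₁ × u₂ = u₃` on `U`. -/
def IsRightHanded (Φ : P3 → P3) (U : Set P3) : Prop :=
  ∀ q ∈ U, crossR (frame Φ 0 q) (frame Φ 1 q) = frame Φ 2 q

/-- Frame vector `uᵢ(q)` viewed inside `ℂ³`. -/
def frameC (Φ : P3 → P3) (i : Fin 3) (q : P3) : V3 := c3 (frame Φ i q)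

/-- Metric coefficient `hᵢ(q)` viewed as a complex number. -/
def hC (Φ : P3 → P3) (i : Fin 3) (q : P3) : ℂ := ((mcoef Φ i q : ℝ) : ℂ)

open Matrix Topology

/-- Componentwise partial derivative of a `ℂ³`-valued field. -/
def vpd (i : Fin 3) (V : P3 → V3) : P3 → V3 := fun p k => pd i (fun r => V r k) p

/-- The partial derivative `∂Φ/∂qᵢ` viewed inside `ℂ³`. -/
def tangentC (Φ : P3 → P3) (i : Fin 3) (q : P3) : V3 := c3 (pdv i Φ q)

theorem pd_congr {g g' : P3 → ℂ} {q : P3} (i : Fin 3) (h : g =ᶠ[𝓝 q] g') :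
    pd i g q = pd i g' q := by
  simp only [pd, h.fderiv_eq]

theorem pd_add {a b : P3 → ℂ} {q : P3} (i : Fin 3)
    (ha : DifferentiableAt ℝ a q) (hb : DifferentiableAt ℝ b q) :
    pd i (fun r => a r + b r) q = pd i a q + pd i b q := by
  simp [pd, fderiv_fun_add ha hb]

theorem pd_sub {a b : P3 → ℂ} {q : P3} (i : Fin 3)
    (ha : DifferentiableAt ℝ a q) (hb : DifferentiableAt ℝ b q) :
    pd i (fun r => a r - b r) q = pd i a q - pd i b q := by
  simp [pd, fderiv_fun_sub ha hb]

theorem pd_mul {a b : P3 → ℂ} {q : P3} (i : Fin 3)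
    (ha : DifferentiableAt ℝ a q) (hb : DifferentiableAt ℝ b q) :
    pd i (fun r => a r * b r) q = pd i a q * b q + a q * pd i b q := by
  simp [pd, fderiv_fun_mul ha hb]
  ring

theorem pd_dotProduct {V W : P3 → V3} {q : P3} (i : Fin 3)
    (hV : ∀ k, DifferentiableAt ℝ (fun r => V r k) q)
    (hW : ∀ k, DifferentiableAt ℝ (fun r => W r k) q) :
    pd i (fun r => V r ⬝ᵥ W r) q = vpd i V q ⬝ᵥ W q + V q ⬝ᵥ vpd i W q := by
  simp only [dotProduct, Fin.sum_univ_three, vpd]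
  rw [pd_add i (((hV 0).fun_mul (hW 0)).fun_add ((hV 1).fun_mul (hW 1)))
      ((hV 2).fun_mul (hW 2)),
    pd_add i ((hV 0).fun_mul (hW 0)) ((hV 1).fun_mul (hW 1)), pd_mul i (hV 0) (hW 0),
    pd_mul i (hV 1) (hW 1), pd_mul i (hV 2) (hW 2)]
  ring

theorem differentiableAt_crossProduct {V W : P3 → V3} {q : P3}
    (hV : ∀ k, DifferentiableAt ℝ (fun r => V r k) q)
    (hW : ∀ k, DifferentiableAt ℝ (fun r => W r k) q) (k : Fin 3) :
    DifferentiableAt ℝ (fun r => (V r ⨯₃ W r) k) q := by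
  fin_cases k <;> simp only [cross_apply] <;>
    exact ((hV _).mul (hW _)).sub ((hV _).mul (hW _))

theorem vpd_crossProduct {V W : P3 → V3} {q : P3} (i : Fin 3)
    (hV : ∀ k, DifferentiableAt ℝ (fun r => V r k) q)
    (hW : ∀ k, DifferentiableAt ℝ (fun r => W r k) q) :
    vpd i (fun r => V r ⨯₃ W r) q = vpd i V q ⨯₃ W q + V q ⨯₃ vpd i W q := by
  have key (a b : Fin 3) : pd i (fun r => V r a * W r b - V r b * W r a) q =
      pd i (fun r => V r a) q * W q b + V q a * pd i (fun r => W r b) q -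
        (pd i (fun r => V r b) q * W q a + V q b * pd i (fun r => W r a) q) := by
    rw [pd_sub i ((hV a).fun_mul (hW b)) ((hV b).fun_mul (hW a)), pd_mul i (hV a) (hW b),
      pd_mul i (hV b) (hW a)]
  ext k
  fin_cases k
  · simp [vpd, cross_apply, key]; ring
  · simp [vpd, cross_apply, key]; ring
  · simp [vpd, cross_apply, key]; ring

/-- Chain rule for partial derivatives. -/
theorem pd_comp {φ : P3 → ℂ} {Φ : P3 → P3} {q : P3} (i : Fin 3)
    (hφ : DifferentiableAt ℝ φ (Φ q)) (hΦ : DifferentiableAt ℝ Φ q) :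
    pd i (fun r => φ (Φ r)) q = grad φ (Φ q) ⬝ᵥ tangentC Φ i q := by
  have h : fderiv ℝ (fun r => φ (Φ r)) q = (fderiv ℝ φ (Φ q)).comp (fderiv ℝ Φ q) :=
    fderiv_comp q hφ hΦ
  have hv (v : P3) : v = v 0 • Pi.single 0 1 + v 1 • Pi.single 1 1 + v 2 • Pi.single 2 1 := by
    ext k; fin_cases k <;> simp
  simp only [pd, h, ContinuousLinearMap.comp_apply]
  rw [hv (fderiv ℝ Φ q (Pi.single i 1))]
  simp [dotProduct, Fin.sum_univ_three, grad, pd, tangentC, c3, pdv, mul_comm]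

theorem differentiableAt_tangentC {Φ : P3 → P3} {q : P3} (hΦ : ContDiffAt ℝ 2 Φ q)
    (i k : Fin 3) : DifferentiableAt ℝ (fun r => tangentC Φ i r k) q := by
  have h : DifferentiableAt ℝ (fderiv ℝ Φ) q :=
    (hΦ.fderiv_right (m := 1) (by norm_num)).differentiableAt (by norm_num)
  have h2 : DifferentiableAt ℝ (fun r => fderiv ℝ Φ r (Pi.single i 1) k) q :=
    differentiableAt_pi.1 (h.clm_apply (differentiableAt_const _)) k
  exact Complex.ofRealCLM.differentiableAt.comp q h2

theorem vpd_tangentC_comm {Φ : P3 → P3} {q : P3} (hΦ : ContDiffAt ℝ 2 Φ q) (i j : Fin 3) :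
    vpd i (tangentC Φ j) q = vpd j (tangentC Φ i) q := by
  have h : DifferentiableAt ℝ (fderiv ℝ Φ) q :=
    (hΦ.fderiv_right (m := 1) (by norm_num)).differentiableAt (by norm_num)
  have hs : IsSymmSndFDerivAt ℝ Φ q := hΦ.isSymmSndFDerivAt (by simp)
  have key (a b k : Fin 3) : vpd a (tangentC Φ b) q k =
      ((fderiv ℝ (fderiv ℝ Φ) q (Pi.single a 1) (Pi.single b 1) k : ℝ) : ℂ) := by
    have h1 : HasFDerivAt (fun r => fderiv ℝ Φ r (Pi.single b 1))
        ((fderiv ℝ (fderiv ℝ Φ) q).flip (Pi.single b 1)) q := by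
      simpa using h.hasFDerivAt.clm_apply (hasFDerivAt_const (Pi.single b (1 : ℝ)) q)
    have h2 := Complex.ofRealCLM.hasFDerivAt.comp q (hasFDerivAt_pi'.1 h1 k)
    exact DFunLike.congr_fun h2.fderiv (Pi.single a 1)
  ext k
  rw [key, key, hs]

/-- The cofactor fields of a Jacobian matrix have vanishing total divergence. -/
theorem piola_identity {Φ : P3 → P3} {q : P3} (hΦ : ContDiffAt ℝ 2 Φ q) :
    vpd 0 (fun r => tangentC Φ 1 r ⨯₃ tangentC Φ 2 r) q +
      vpd 1 (fun r => tangentC Φ 2 r ⨯₃ tangentC Φ 0 r) q +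
      vpd 2 (fun r => tangentC Φ 0 r ⨯₃ tangentC Φ 1 r) q = 0 := by
  have hd := differentiableAt_tangentC hΦ
  rw [vpd_crossProduct 0 (hd 1) (hd 2), vpd_crossProduct 1 (hd 2) (hd 0),
    vpd_crossProduct 2 (hd 0) (hd 1), vpd_tangentC_comm hΦ 1 0, vpd_tangentC_comm hΦ 2 0,
    vpd_tangentC_comm hΦ 2 1, ← cross_anticomm (tangentC Φ 1 q),
    ← cross_anticomm _ (tangentC Φ 2 q), ← cross_anticomm _ (tangentC Φ 0 q)]
  abel

theorem mcoef_pos {Φ : P3 → P3} {q : P3} {i : Fin 3} (h : pdv i Φ q ≠ 0) : 0 < mcoef Φ i q := by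
  have h3 : dotR (pdv i Φ q) (pdv i Φ q) = pdv i Φ q ⬝ᵥ pdv i Φ q := by
    simp [dotR, dotProduct, Fin.sum_univ_three]
  rw [mcoef, h3]
  refine Real.sqrt_pos.2 (lt_of_le_of_ne ?_ (Ne.symm (mt dotProduct_self_eq_zero.1 h)))
  exact Finset.sum_nonneg fun k _ => mul_self_nonneg _

theorem tangentC_eq {Φ : P3 → P3} {q : P3} {i : Fin 3} (h : pdv i Φ q ≠ 0) :
    tangentC Φ i q = hC Φ i q • frameC Φ i q := by
  ext k
  have := (mcoef_pos h).ne'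
  simp only [tangentC, c3, hC, frameC, frame, Pi.smul_apply, smul_eq_mul]
  norm_cast
  field_simp

theorem frameC_dotProduct {Φ : P3 → P3} {U : Set P3} (horth : IsOrthogonalCurvilinear Φ U)
    {q : P3} (hq : q ∈ U) (i j : Fin 3) :
    frameC Φ i q ⬝ᵥ frameC Φ j q = if i = j then 1 else 0 := by
  have hc : frameC Φ i q ⬝ᵥ frameC Φ j q =
      (((mcoef Φ i q)⁻¹ * (mcoef Φ j q)⁻¹ * dotR (pdv i Φ q) (pdv j Φ q) : ℝ) : ℂ) := by
    simp only [dotProduct, Fin.sum_univ_three, frameC, frame, c3, dotR, Pi.smul_apply,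
      smul_eq_mul]
    push_cast
    ring
  rw [hc]
  split_ifs with hij
  · subst hij
    have hp := mcoef_pos ((horth q hq).2 i)
    have hs : dotR (pdv i Φ q) (pdv i Φ q) = mcoef Φ i q ^ 2 :=
      (Real.sq_sqrt (Real.sqrt_pos.1 hp).le).symm
    rw [hs]
    have := hp.ne'
    norm_cast
    field_simp
  · simp [(horth q hq).1 i j hij]

theorem frameC_crossProduct {Φ : P3 → P3} {q : P3}
    (h : crossR (frame Φ 0 q) (frame Φ 1 q) = frame Φ 2 q) :
    frameC Φ 0 q ⨯₃ frameC Φ 1 q = frameC Φ 2 q := by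
  ext k
  rw [frameC, frameC, frameC, ← h]
  fin_cases k <;> simp [cross_apply, c3, crossR]

section Orthonormal

variable {e : Fin 3 → V3}

theorem orthonormal_completeness (he : ∀ i j, e i ⬝ᵥ e j = if i = j then 1 else 0) (k l : Fin 3) :
    e 0 k * e 0 l + e 1 k * e 1 l + e 2 k * e 2 l = if k = l then 1 else 0 := by
  have h : Matrix.of e * (Matrix.of e)ᵀ = 1 := by
    ext i j
    simpa [Matrix.mul_apply, dotProduct, Matrix.one_apply] using he i j
  have h' := mul_eq_one_comm.1 h
  have h2 := congr_fun (congr_fun h' k) l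
  simpa [Matrix.mul_apply, Fin.sum_univ_three, Matrix.one_apply] using h2

theorem orthonormal_cross_one_two (he : ∀ i j, e i ⬝ᵥ e j = if i = j then 1 else 0)
    (hc : e 0 ⨯₃ e 1 = e 2) : e 1 ⨯₃ e 2 = e 0 := by
  have h11 := he 1 1
  have h10 := he 1 0
  simp only [dotProduct, Fin.sum_univ_three] at h11 h10
  norm_num at h11 h10
  rw [← hc]
  ext k
  fin_cases k <;> simp [cross_apply]
  · linear_combination e 0 0 * h11 - e 1 0 * h10
  · linear_combination e 0 1 * h11 - e 1 1 * h10
  · linear_combination e 0 2 * h11 - e 1 2 * h10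

theorem orthonormal_cross_two_zero (he : ∀ i j, e i ⬝ᵥ e j = if i = j then 1 else 0)
    (hc : e 0 ⨯₃ e 1 = e 2) : e 2 ⨯₃ e 0 = e 1 := by
  have h00 := he 0 0
  have h10 := he 1 0
  simp only [dotProduct, Fin.sum_univ_three] at h00 h10
  norm_num at h00 h10
  rw [← hc]
  ext k
  fin_cases k <;> simp [cross_apply]
  · linear_combination e 1 0 * h00 - e 0 0 * h10
  · linear_combination e 1 1 * h00 - e 0 1 * h10
  · linear_combination e 1 2 * h00 - e 0 2 * h10

/-- A vector is recovered from its coordinates in an orthonormal frame. -/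
theorem orthonormal_expansion (he : ∀ i j, e i ⬝ᵥ e j = if i = j then 1 else 0) (c : V3) :
    (c ⬝ᵥ e 0) • e 0 + (c ⬝ᵥ e 1) • e 1 + (c ⬝ᵥ e 2) • e 2 = c := by
  have h := orthonormal_completeness he
  ext k
  have h0 := h 0 k
  have h1 := h 1 k
  have h2 := h 2 k
  simp only [dotProduct, Fin.sum_univ_three, Pi.add_apply, Pi.smul_apply, smul_eq_mul]
  have hk : c k = c 0 * (if 0 = k then 1 else 0) + c 1 * (if 1 = k then 1 else 0) +
      c 2 * (if 2 = k then 1 else 0) := by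
    fin_cases k <;> simp
  rw [hk]
  linear_combination c 0 * h0 + c 1 * h1 + c 2 * h2

/-- The trace of a matrix in an orthonormal frame. -/
theorem orthonormal_trace (he : ∀ i j, e i ⬝ᵥ e j = if i = j then 1 else 0)
    (A : Matrix (Fin 3) (Fin 3) ℂ) :
    (A *ᵥ e 0) ⬝ᵥ e 0 + (A *ᵥ e 1) ⬝ᵥ e 1 + (A *ᵥ e 2) ⬝ᵥ e 2 = A 0 0 + A 1 1 + A 2 2 := by
  have h (k : Fin 3) := orthonormal_expansion he (A k)
  have h0 := congr_fun (h 0) 0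
  have h1 := congr_fun (h 1) 1
  have h2 := congr_fun (h 2) 2
  simp only [mulVec, dotProduct, Fin.sum_univ_three, Pi.add_apply, Pi.smul_apply,
    smul_eq_mul] at h0 h1 h2 ⊢
  linear_combination h0 + h1 + h2

end Orthonormal

/-- The curl attached to a Jacobian matrix. -/
def matCurl (A : Matrix (Fin 3) (Fin 3) ℂ) : V3 := ![A 2 1 - A 1 2, A 0 2 - A 2 0, A 1 0 - A 0 1]

theorem mulVec_dotProduct_sub (A : Matrix (Fin 3) (Fin 3) ℂ) (v w : V3) :
    (A *ᵥ v) ⬝ᵥ w - (A *ᵥ w) ⬝ᵥ v = matCurl A ⬝ᵥ (v ⨯₃ w) := by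
  simp [mulVec, dotProduct, Fin.sum_univ_three, matCurl, cross_apply]
  ring

/-- The Jacobian matrix of a `ℂ³`-valued field. -/
def jac (V : P3 → V3) (p : P3) : Matrix (Fin 3) (Fin 3) ℂ :=
  Matrix.of fun k => grad (fun r => V r k) p

theorem DMT_eq_mkQ (f : P3 → ℍ[ℂ]) (p : P3) :
    DMT f p = mkQ (-(jac (vf f) p 0 0 + jac (vf f) p 1 1 + jac (vf f) p 2 2))
      (grad (sc f) p + matCurl (jac (vf f) p)) := by
  have hsc : sc f = fun q => (f q).re := rfl
  apply Quaternion.ext <;>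
    simp only [DMT, Quaternion.re_add, Quaternion.imI_add, Quaternion.imJ_add, Quaternion.imK_add,
      Quaternion.re_mul, Quaternion.imI_mul, Quaternion.imJ_mul, Quaternion.imK_mul] <;>
    simp [mkQ, qi, qj, qk, qpd, jac, grad, vf, vecQ, hsc, matCurl] <;> ring

theorem vpd_comp {V : P3 → V3} {Φ : P3 → P3} {q : P3} (i : Fin 3)
    (hV : ∀ k, DifferentiableAt ℝ (fun r => V r k) (Φ q)) (hΦ : DifferentiableAt ℝ Φ q) :
    vpd i (fun r => V (Φ r)) q = jac V (Φ q) *ᵥ tangentC Φ i q := by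
  ext k
  exact pd_comp i (hV k) hΦ

/-- Let `Φ : U → ℝ³` be a `C²` orthogonal curvilinear coordinate map
with metric coefficients `hᵢ` and right-handed frame `uᵢ`, and let `f ∈ C¹(Ω; ℍ(ℂ))`
with `Φ(U) ⊆ Ω` have curvilinear component functions `F₀, F₁, F₂, F₃`, i.e.
`(f∘Φ)(q) = F₀(q) + F₁(q)u₁(q) + F₂(q)u₂(q) + F₃(q)u₃(q)` on `U`.  Then for every
`q ∈ U`, `D_MT[f](Φ(q))` is given by the classical curvilinear expression. -/
theorem DMT_curvilinear (U Ω : Set P3) (hU : IsOpen U) (hΩ : IsOpen Ω)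
    (Φ : P3 → P3) (hΦ : ContDiffOn ℝ 2 Φ U)
    (horth : IsOrthogonalCurvilinear Φ U) (hrh : IsRightHanded Φ U)
    (hΦΩ : ∀ q ∈ U, Φ q ∈ Ω)
    (f : P3 → ℍ[ℂ]) (hf : QContDiffOn 1 f Ω)
    (F₀ F₁ F₂ F₃ : P3 → ℂ)
    (hdec : ∀ q ∈ U, f (Φ q) =
      mkQ (F₀ q) (F₁ q • frameC Φ 0 q + F₂ q • frameC Φ 1 q + F₃ q • frameC Φ 2 q)) :
    ∀ q ∈ U, DMT f (Φ q) =
      mkQ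
        (-(1 / (hC Φ 0 q * hC Φ 1 q * hC Φ 2 q)) *
          (pd 0 (fun r => hC Φ 1 r * hC Φ 2 r * F₁ r) q +
           pd 1 (fun r => hC Φ 0 r * hC Φ 2 r * F₂ r) q +
           pd 2 (fun r => hC Φ 0 r * hC Φ 1 r * F₃ r) q))
        (((1 / hC Φ 0 q) * pd 0 F₀ q +
            (1 / (hC Φ 1 q * hC Φ 2 q)) *
              (pd 1 (fun r => hC Φ 2 r * F₃ r) q -
               pd 2 (fun r => hC Φ 1 r * F₂ r) q)) • frameC Φ 0 q +
         ((1 / hC Φ 1 q) * pd 1 F₀ q +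
            (1 / (hC Φ 0 q * hC Φ 2 q)) *
              (pd 2 (fun r => hC Φ 0 r * F₁ r) q -
               pd 0 (fun r => hC Φ 2 r * F₃ r) q)) • frameC Φ 1 q +
         ((1 / hC Φ 2 q) * pd 2 F₀ q +
            (1 / (hC Φ 0 q * hC Φ 1 q)) *
              (pd 0 (fun r => hC Φ 1 r * F₂ r) q -
               pd 1 (fun r => hC Φ 0 r * F₁ r) q)) • frameC Φ 2 q) := by
  intro q hq
  have hUq : ∀ᶠ r in 𝓝 q, r ∈ U := hU.mem_nhds hq
  have hΦq : ContDiffAt ℝ 2 Φ q := hΦ.contDiffAt hUq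
  have hΦd : DifferentiableAt ℝ Φ q := hΦq.differentiableAt (by norm_num)
  have hΩq : Ω ∈ 𝓝 (Φ q) := hΩ.mem_nhds (hΦΩ q hq)
  have hsc : DifferentiableAt ℝ (sc f) (Φ q) := (hf.1.contDiffAt hΩq).differentiableAt (by norm_num)
  have hvf (k : Fin 3) : DifferentiableAt ℝ (fun r => vf f r k) (Φ q) := by
    fin_cases k
    · exact (hf.2.1.contDiffAt hΩq).differentiableAt (by norm_num)
    · exact (hf.2.2.1.contDiffAt hΩq).differentiableAt (by norm_num)
    · exact (hf.2.2.2.contDiffAt hΩq).differentiableAt (by norm_num)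
  have hX := differentiableAt_tangentC hΦq
  have hg (k : Fin 3) : DifferentiableAt ℝ (fun r => vf f (Φ r) k) q := (hvf k).comp q hΦd
  have hXe (r : P3) (hr : r ∈ U) (i : Fin 3) := tangentC_eq ((horth r hr).2 i)
  have hF₀ (r : P3) (hr : r ∈ U) : F₀ r = sc f (Φ r) := by
    rw [sc, hdec r hr]; rfl
  have hvec (r : P3) (hr : r ∈ U) : vf f (Φ r) =
      F₁ r • frameC Φ 0 r + F₂ r • frameC Φ 1 r + F₃ r • frameC Φ 2 r := by
    rw [vf, hdec r hr]
    ext k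
    fin_cases k <;> rfl
  have hdot (r : P3) (hr : r ∈ U) := frameC_dotProduct horth hr
  have hcross (r : P3) (hr : r ∈ U) := frameC_crossProduct (hrh r hr)
  have hcross₁ (r : P3) (hr : r ∈ U) : frameC Φ 1 r ⨯₃ frameC Φ 2 r = frameC Φ 0 r :=
    orthonormal_cross_one_two (e := fun i => frameC Φ i r) (hdot r hr) (hcross r hr)
  have hcross₂ (r : P3) (hr : r ∈ U) : frameC Φ 2 r ⨯₃ frameC Φ 0 r = frameC Φ 1 r :=
    orthonormal_cross_two_zero (e := fun i => frameC Φ i r) (hdot r hr) (hcross r hr)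
  have hF₁ (r : P3) (hr : r ∈ U) : hC Φ 0 r * F₁ r = vf f (Φ r) ⬝ᵥ tangentC Φ 0 r := by
    simp [hvec r hr, hXe r hr, add_dotProduct, hdot r hr]
  have hF₂ (r : P3) (hr : r ∈ U) : hC Φ 1 r * F₂ r = vf f (Φ r) ⬝ᵥ tangentC Φ 1 r := by
    simp [hvec r hr, hXe r hr, add_dotProduct, hdot r hr]
  have hF₃ (r : P3) (hr : r ∈ U) : hC Φ 2 r * F₃ r = vf f (Φ r) ⬝ᵥ tangentC Φ 2 r := by
    simp [hvec r hr, hXe r hr, add_dotProduct, hdot r hr]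
  have hD₁ (r : P3) (hr : r ∈ U) : hC Φ 1 r * hC Φ 2 r * F₁ r =
      vf f (Φ r) ⬝ᵥ (tangentC Φ 1 r ⨯₃ tangentC Φ 2 r) := by
    simp [hvec r hr, hXe r hr, add_dotProduct, hdot r hr, hcross₁ r hr]
    ring
  have hD₂ (r : P3) (hr : r ∈ U) : hC Φ 0 r * hC Φ 2 r * F₂ r =
      vf f (Φ r) ⬝ᵥ (tangentC Φ 2 r ⨯₃ tangentC Φ 0 r) := by
    simp [hvec r hr, hXe r hr, add_dotProduct, hdot r hr, hcross₂ r hr]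
    ring
  have hD₃ (r : P3) (hr : r ∈ U) : hC Φ 0 r * hC Φ 1 r * F₃ r =
      vf f (Φ r) ⬝ᵥ (tangentC Φ 0 r ⨯₃ tangentC Φ 1 r) := by
    simp [hvec r hr, hXe r hr, add_dotProduct, hdot r hr, hcross r hr]
    ring
  have hh (i : Fin 3) : hC Φ i q ≠ 0 :=
    Complex.ofReal_ne_zero.2 (mcoef_pos ((horth q hq).2 i)).ne'
  have hgrad (i : Fin 3) : 1 / hC Φ i q * pd i F₀ q = grad (sc f) (Φ q) ⬝ᵥ frameC Φ i q := by
    rw [pd_congr i (hUq.mono hF₀), pd_comp i hsc hΦd, hXe q hq, dotProduct_smul, smul_eq_mul]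
    field_simp [hh i]
  have hvpd (i : Fin 3) : vpd i (fun r => vf f (Φ r)) q =
      hC Φ i q • (jac (vf f) (Φ q) *ᵥ frameC Φ i q) := by
    rw [vpd_comp i hvf hΦd, hXe q hq, mulVec_smul]
  have hcurl (i j : Fin 3) : 1 / (hC Φ i q * hC Φ j q) *
      (pd i (fun r => vf f (Φ r) ⬝ᵥ tangentC Φ j r) q -
        pd j (fun r => vf f (Φ r) ⬝ᵥ tangentC Φ i r) q) =
      matCurl (jac (vf f) (Φ q)) ⬝ᵥ (frameC Φ i q ⨯₃ frameC Φ j q) := by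
    rw [pd_dotProduct i hg (hX j), pd_dotProduct j hg (hX i), vpd_tangentC_comm hΦq i j,
      add_sub_add_right_eq_sub, hvpd, hvpd, hXe q hq, hXe q hq, ← mulVec_dotProduct_sub]
    simp only [smul_dotProduct, dotProduct_smul, smul_eq_mul]
    field_simp [hh i, hh j]
  have hdiv : pd 0 (fun r => hC Φ 1 r * hC Φ 2 r * F₁ r) q +
      pd 1 (fun r => hC Φ 0 r * hC Φ 2 r * F₂ r) q +
      pd 2 (fun r => hC Φ 0 r * hC Φ 1 r * F₃ r) q =
      hC Φ 0 q * hC Φ 1 q * hC Φ 2 q * (jac (vf f) (Φ q) 0 0 + jac (vf f) (Φ q) 1 1 +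
        jac (vf f) (Φ q) 2 2) := by
    have hp := congr_arg (vf f (Φ q) ⬝ᵥ ·) (piola_identity hΦq)
    simp only [dotProduct_add, dotProduct_zero] at hp
    rw [pd_congr 0 (hUq.mono hD₁), pd_congr 1 (hUq.mono hD₂), pd_congr 2 (hUq.mono hD₃),
      pd_dotProduct 0 hg (differentiableAt_crossProduct (hX 1) (hX 2)),
      pd_dotProduct 1 hg (differentiableAt_crossProduct (hX 2) (hX 0)),
      pd_dotProduct 2 hg (differentiableAt_crossProduct (hX 0) (hX 1)),
      ← orthonormal_trace (e := fun i => frameC Φ i q) (hdot q hq)]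
    simp only [hvpd, hXe q hq, map_smul, LinearMap.smul_apply, hcross q hq, hcross₁ q hq,
      hcross₂ q hq, smul_dotProduct, dotProduct_smul, smul_eq_mul]
    linear_combination hp
  rw [hdiv, pd_congr 1 (hUq.mono hF₃), pd_congr 2 (hUq.mono hF₂), pd_congr 2 (hUq.mono hF₁),
    pd_congr 0 (hUq.mono hF₃), pd_congr 0 (hUq.mono hF₂), pd_congr 1 (hUq.mono hF₁),
    hgrad, hgrad, hgrad, hcurl, hcurl, mul_comm (hC Φ 0 q) (hC Φ 2 q), hcurl,
    hcross q hq, hcross₁ q hq, hcross₂ q hq, ← add_dotProduct, ← add_dotProduct,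
    ← add_dotProduct, orthonormal_expansion (e := fun i => frameC Φ i q) (hdot q hq), DMT_eq_mkQ]
  congr 1
  field_simp [hh 0, hh 1, hh 2]
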